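/- Let 𝒥 be the ideal of H*(GQ_{2n−1}) generated by the elements M_i − Q for 1 ≤ i ≤ n, and let K ⊆ V be an independent subset with |K| = n. Then the quotient ring H*(GQ_{2n−1})/𝒥 is isomorphic to ℤ[c,x]/⟨c^n − 2x, x²⟩, where the images of Q and Δ_K correspond to c and x respectively. In particular, Q^n − 2Δ_K ∈ 𝒥 and Δ_K² ∈ 𝒥. -/

import Mathlib

open MvPolynomial Finset

noncomputable section

abbrev Rr (n : ℕ) := MvPolynomial (Fin n) ℤ

/-- The "opposite" vertex: 0-indexed version of i ↦ 2n+1−i. -/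
def bar {n : ℕ} (i : Fin (2*n)) : Fin (2*n) :=
  ⟨2*n - 1 - i.val, by have := i.isLt; omega⟩

/-- The weight α_i (0-indexed): α_i = X i for i < n, and α_i = −α_{bar i} otherwise. -/
def av {n : ℕ} (i : Fin (2*n)) : Rr n :=
  if h : i.val < n then X ⟨i.val, h⟩
  else - X ⟨2*n - 1 - i.val, by have := i.isLt; omega⟩

/-- The axial function α(ij). -/
def ax {n : ℕ} (i j : Fin (2*n)) : Rr n :=
  if j = bar i then - av i else - av i + av j

/-- The class M_v. -/
def Mv {n : ℕ} (v : Fin (2*n)) : Fin (2*n) → Rr n := fun j =>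
  if j = v then 0 else if j = bar v then 2 * av v else - av j + av v

/-- The class Q. -/
def Qf {n : ℕ} : Fin (2*n) → Rr n := fun j => - av j

/-- Independence: K contains no pair {i, bar i}. -/
def indep {n : ℕ} (K : Finset (Fin (2*n))) : Prop :=
  ∀ i : Fin (2*n), ¬ ({i, bar i} : Finset (Fin (2*n))) ⊆ K

/-- The class Δ_K. -/
def Del {n : ℕ} (K : Finset (Fin (2*n))) : Fin (2*n) → Rr n := fun j =>
  if j ∈ K then ∏ k ∈ Kᶜ, ax j k else 0

/-- The class Δ'_K. -/
def Del' {n : ℕ} (K : Finset (Fin (2*n))) : Fin (2*n) → Rr n := fun j =>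
  if j ∈ K then ∏ k ∈ (K ∪ {bar j})ᶜ, ax j k else 0

/-- The graph equivariant cohomology H*(GQ_{2n−1}) as a subring of the ring of
functions V → R with pointwise operations. -/
def HGQ (n : ℕ) : Subring (Fin (2*n) → Rr n) where
  carrier := {f | ∀ i j : Fin (2*n), i ≠ j → ax i j ∣ f i - f j}
  zero_mem' := fun i j _ => by simp
  one_mem' := fun i j _ => by simp
  add_mem' := by
    intro a b ha hb i j h
    have e : (a + b) i - (a + b) j = (a i - a j) + (b i - b j) := by
      simp only [Pi.add_apply]; ring
    rw [e]; exact dvd_add (ha i j h) (hb i j h)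
  neg_mem' := by
    intro a ha i j h
    have e : (-a) i - (-a) j = -(a i - a j) := by
      simp only [Pi.neg_apply]; ring
    rw [e]; exact dvd_neg.mpr (ha i j h)
  mul_mem' := by
    intro a b ha hb i j h
    have e : (a * b) i - (a * b) j = a i * (b i - b j) + (a i - a j) * b j := by
      simp only [Pi.mul_apply]; ring
    rw [e]; exact dvd_add ((hb i j h).mul_left _) ((ha i j h).mul_right _)

/-- The graph equivariant cohomology H*(GQ_{2n−2}) (edges i j with j ≠ bar i only). -/
def HGQe (n : ℕ) : Subring (Fin (2*n) → Rr n) where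
  carrier := {f | ∀ i j : Fin (2*n), i ≠ j → j ≠ bar i → ax i j ∣ f i - f j}
  zero_mem' := fun i j _ _ => by simp
  one_mem' := fun i j _ _ => by simp
  add_mem' := by
    intro a b ha hb i j h h'
    have e : (a + b) i - (a + b) j = (a i - a j) + (b i - b j) := by
      simp only [Pi.add_apply]; ring
    rw [e]; exact dvd_add (ha i j h h') (hb i j h h')
  neg_mem' := by
    intro a ha i j h h'
    have e : (-a) i - (-a) j = -(a i - a j) := by
      simp only [Pi.neg_apply]; ring
    rw [e]; exact dvd_neg.mpr (ha i j h h')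
  mul_mem' := by
    intro a b ha hb i j h h'
    have e : (a * b) i - (a * b) j = a i * (b i - b j) + (a i - a j) * b j := by
      simp only [Pi.mul_apply]; ring
    rw [e]; exact dvd_add ((hb i j h h').mul_left _) ((ha i j h h').mul_right _)


/-- The ideal 𝒥 of H*(GQ_{2n−1}) generated by the elements M_i − Q for 1 ≤ i ≤ n. -/
def Jideal (n : ℕ) : Ideal (HGQ n) :=
  Ideal.span {g : HGQ n | ∃ i : Fin (2*n), i.val < n ∧
    (g : Fin (2*n) → Rr n) = Mv i - Qf}

section Interpolation

/-- Newton interpolation over a commutative ring in which the divided differences exist. -/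
theorem exists_interpolating_poly {ι R : Type*} [CommRing R] (y : ι → R)
    (S : Finset ι) (f : ι → R)
    (hf : ∀ i ∈ S, ∀ j ∈ S, i ≠ j → y i - y j ∣ f i - f j)
    (hy : ∀ i ∈ S, ∀ j ∈ S, ∀ k ∈ S, i ≠ j → i ≠ k → j ≠ k →
      ∀ c, y i - y j ∣ c * (y i - y k) → y i - y j ∣ c) :
    ∃ P : Polynomial R, P.degree < S.card ∧ ∀ i ∈ S, P.eval (y i) = f i := by
  classical
  induction S using Finset.induction_on generalizing f with
  | empty => exact ⟨0, by simp, by simp⟩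
  | insert a S ha ih =>
    have hg : ∀ i, ∃ g, i ∈ S → f i - f a = (y i - y a) * g := by
      intro i
      by_cases hi : i ∈ S
      · obtain ⟨g, hg⟩ := hf i (mem_insert_of_mem hi) a (mem_insert_self a S)
          (by rintro rfl; exact ha hi)
        exact ⟨g, fun _ => hg⟩
      · exact ⟨0, fun h => absurd h hi⟩
    choose g hg using hg
    obtain ⟨P, hPd, hP⟩ := ih g
      (by
        intro i hi j hj hij
        refine hy i (mem_insert_of_mem hi) j (mem_insert_of_mem hj) a (mem_insert_self a S) hij
          (by rintro rfl; exact ha hi) (by rintro rfl; exact ha hj) _ ?_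
        have e : (g i - g j) * (y i - y a) = (f i - f j) - (y i - y j) * g j := by
          linear_combination - hg i hi + hg j hj
        rw [e]
        exact dvd_sub (hf i (mem_insert_of_mem hi) j (mem_insert_of_mem hj) hij)
          (dvd_mul_right _ _))
      (fun i hi j hj k hk => hy i (mem_insert_of_mem hi) j (mem_insert_of_mem hj) k
        (mem_insert_of_mem hk))
    refine ⟨Polynomial.C (f a) + (Polynomial.X * P - Polynomial.C (y a) * P), ?_, ?_⟩
    · rw [card_insert_of_notMem ha, Polynomial.degree_lt_iff_coeff_zero]
      rw [Polynomial.degree_lt_iff_coeff_zero] at hPd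
      intro m hm
      obtain ⟨m, rfl⟩ : ∃ k, m = k + 1 := ⟨m - 1, by omega⟩
      simp [Polynomial.coeff_C_succ, hPd m (by omega), hPd (m + 1) (by omega)]
    · intro i hi
      rcases mem_insert.mp hi with rfl | hi
      · simp
      · simp only [Polynomial.eval_add, Polynomial.eval_C, Polynomial.eval_sub,
          Polynomial.eval_mul, Polynomial.eval_X, hP i hi]
        linear_combination - hg i hi

theorem exists_half_prod_sub_prod {ι R T : Type*} [CommRing R] [CommRing T] (ε : R →+* T)
    (a : ι → R) (ha : ∀ i, ε (a i) = 0) (S : Finset ι) :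
    ∃ P : Polynomial R, ∏ i ∈ S, (Polynomial.X - Polynomial.C (a i)) -
      ∏ i ∈ S, (Polynomial.X + Polynomial.C (a i)) = 2 * P ∧ P.map ε = 0 := by
  classical
  induction S using Finset.induction_on with
  | empty => exact ⟨0, by simp, by simp⟩
  | insert b S hb ih =>
    obtain ⟨P, hP, hε⟩ := ih
    refine ⟨Polynomial.X * P - Polynomial.C (a b) *
      (∏ i ∈ S, (Polynomial.X - Polynomial.C (a i)) - P), ?_, by simp [hε, ha]⟩
    rw [prod_insert hb, prod_insert hb]
    linear_combination (Polynomial.X + Polynomial.C (a b)) * hP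

/-- Normal form in a ring with elements satisfying the relations `c ^ n = 2 * x`, `x ^ 2 = 0`. -/
theorem aeval_eq_normal_form {A : Type*} [CommRing A] [Algebra ℤ A] {n : ℕ} {c x : A}
    (h1 : c ^ n = 2 * x) (h2 : x ^ 2 = 0) (F : MvPolynomial (Fin 2) ℤ) :
    ∃ P q : Polynomial ℤ, P.degree < n ∧ q.degree < n ∧
      MvPolynomial.aeval ![c, x] F = Polynomial.aeval c P + x * Polynomial.aeval c q := by
  have key : ∃ P q : Polynomial ℤ,
      MvPolynomial.aeval ![c, x] F = Polynomial.aeval c P + x * Polynomial.aeval c q := by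
    induction F using MvPolynomial.induction_on with
    | C a => exact ⟨Polynomial.C a, 0, by simp⟩
    | add p q hp hq =>
      obtain ⟨P, q, h⟩ := hp
      obtain ⟨P', q', h'⟩ := hq
      exact ⟨P + P', q + q', by simp only [map_add, h, h']; ring⟩
    | mul_X p i hp =>
      obtain ⟨P, q, h⟩ := hp
      fin_cases i
      · refine ⟨P * Polynomial.X, q * Polynomial.X, ?_⟩
        simp [h]
        ring
      · refine ⟨0, P, ?_⟩
        simp [h]
        linear_combination Polynomial.aeval c q * h2
  obtain ⟨P, q, h⟩ := key
  have hm : (Polynomial.X ^ n : Polynomial ℤ).Monic := Polynomial.monic_X_pow n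
  have hdeg (p : Polynomial ℤ) : (p %ₘ Polynomial.X ^ n).degree < n := by
    simpa using Polynomial.degree_modByMonic_lt p hm
  have hdiv (p : Polynomial ℤ) : Polynomial.aeval c p =
      Polynomial.aeval c (p %ₘ Polynomial.X ^ n) +
        2 * x * Polynomial.aeval c (p /ₘ Polynomial.X ^ n) := by
    conv_lhs => rw [← Polynomial.modByMonic_add_div p (Polynomial.X ^ n)]
    simp [h1]
  refine ⟨P %ₘ Polynomial.X ^ n, (q + 2 * (P /ₘ Polynomial.X ^ n)) %ₘ Polynomial.X ^ n,
    hdeg _, hdeg _, ?_⟩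
  have h3 := hdiv (q + 2 * (P /ₘ Polynomial.X ^ n))
  simp only [map_add, map_mul, map_ofNat] at h3
  rw [h, hdiv P]
  linear_combination x * h3 +
    2 * Polynomial.aeval c ((q + 2 * (P /ₘ Polynomial.X ^ n)) /ₘ Polynomial.X ^ n) * h2

end Interpolation

section Weights

variable {n : ℕ}

theorem bar_bar (i : Fin (2*n)) : bar (bar i) = i := by
  ext; simp only [bar]; omega

theorem bar_injective : Function.Injective (bar (n := n)) :=
  Function.LeftInverse.injective bar_bar

theorem av_bar (i : Fin (2*n)) : av (bar i) = - av i := by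
  have hi := i.isLt
  by_cases h : i.val < n
  · have h' : ¬ (2*n - 1 - i.val < n) := by omega
    have e : 2*n - 1 - (2*n - 1 - i.val) = i.val := by omega
    simp [av, bar, h, h', e]
  · have h' : 2*n - 1 - i.val < n := by omega
    simp [av, bar, h, h']

/-- The vertex whose weight is the variable `X m`. -/
def vtx (m : Fin n) : Fin (2*n) := ⟨m.val, by omega⟩

theorem av_vtx (m : Fin n) : av (vtx m) = X m := by
  simp [av, vtx]

theorem exists_vtx (i : Fin (2*n)) : ∃ m, i = vtx m ∨ i = bar (vtx m) := by
  have hi := i.isLt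
  by_cases h : i.val < n
  · exact ⟨⟨i.val, h⟩, Or.inl rfl⟩
  · refine ⟨⟨2*n - 1 - i.val, by omega⟩, Or.inr ?_⟩
    ext; simp only [bar, vtx]; omega

theorem constantCoeff_av (i : Fin (2*n)) : constantCoeff (av i) = 0 := by
  obtain ⟨m, rfl | rfl⟩ := exists_vtx i <;> simp [av_bar, av_vtx]

theorem av_ne_zero (i : Fin (2*n)) : av i ≠ 0 := by
  obtain ⟨m, rfl | rfl⟩ := exists_vtx i <;> simp [av_bar, av_vtx]

/-- Substitution of `s` for the weight of `j`. -/
theorem exists_subst (j : Fin (2*n)) (s : Rr n) : ∃ φ : Rr n →ₐ[ℤ] Rr n, φ (av j) = s ∧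
    ∀ l, l ≠ j → l ≠ bar j → φ (av l) = av l := by
  have aux (m : Fin n) (s : Rr n) : ∃ φ : Rr n →ₐ[ℤ] Rr n, φ (av (vtx m)) = s ∧
      ∀ l, l ≠ vtx m → l ≠ bar (vtx m) → φ (av l) = av l := by
    refine ⟨aeval (Function.update X m s), by simp [av_vtx], fun l h1 h2 => ?_⟩
    obtain ⟨k, rfl | rfl⟩ := exists_vtx l
    · have : k ≠ m := fun h => h1 (h ▸ rfl)
      simp [av_vtx, this]
    · have : k ≠ m := fun h => h2 (h ▸ rfl)
      simp [av_bar, av_vtx, this]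
  obtain ⟨m, rfl | rfl⟩ := exists_vtx j
  · exact aux m s
  · obtain ⟨φ, h1, h2⟩ := aux m (-s)
    refine ⟨φ, by simp [av_bar, h1], fun l h h' => h2 l ?_ h⟩
    rwa [bar_bar] at h'

theorem av_injective : Function.Injective (av (n := n)) := by
  intro i j h
  by_contra hij
  obtain ⟨φ, h1, h2⟩ := exists_subst i 0
  by_cases hb : j = bar i
  · rw [hb, av_bar] at h
    exact av_ne_zero i (self_eq_neg.mp h)
  · have := h2 j (Ne.symm hij) hb
    rw [← h, h1] at this
    exact av_ne_zero i this.symm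

theorem sub_dvd_iff {j : Fin (2*n)} {s : Rr n} {φ : Rr n →ₐ[ℤ] Rr n} (h1 : φ (av j) = s)
    (h2 : ∀ l, l ≠ j → l ≠ bar j → φ (av l) = av l) (hs : φ s = s) (f : Rr n) :
    av j - s ∣ f ↔ φ f = 0 := by
  constructor
  · rintro ⟨g, rfl⟩
    simp [h1, hs]
  · intro h
    suffices H : av j - s ∣ f - φ f by simpa [h] using H
    clear h
    induction f using MvPolynomial.induction_on with
    | C a => simp
    | add p q hp hq =>
      rw [map_add, add_sub_add_comm]
      exact dvd_add hp hq
    | mul_X p m hp =>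
      have hX : av j - s ∣ X m - φ (X m) := by
        rw [← av_vtx]
        by_cases e1 : vtx m = j
        · rw [e1, h1]
        by_cases e2 : vtx m = bar j
        · rw [e2, av_bar, map_neg, h1, ← neg_dvd]
          exact dvd_of_eq (by ring)
        · simp [h2 _ e1 e2]
      have e : p * X m - φ (p * X m) = (p - φ p) * X m + φ p * (X m - φ (X m)) := by
        rw [map_mul]; ring
      rw [e]
      exact dvd_add (hp.mul_right _) (hX.mul_left _)

theorem exists_ax_dvd_iff {j k : Fin (2*n)} (hjk : j ≠ k) : ∃ φ : Rr n →ₐ[ℤ] Rr n,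
    φ (av j) = (if k = bar j then 0 else av k) ∧
    (∀ l, l ≠ j → l ≠ bar j → φ (av l) = av l) ∧ ∀ f, ax j k ∣ f ↔ φ f = 0 := by
  obtain ⟨φ, h1, h2⟩ := exists_subst j (if k = bar j then 0 else av k)
  refine ⟨φ, h1, h2, fun f => ?_⟩
  have hs : φ (if k = bar j then 0 else av k) = if k = bar j then 0 else av k := by
    split_ifs with h
    · simp
    · exact h2 k hjk.symm h
  rw [← sub_dvd_iff h1 h2 hs, ← neg_dvd]
  have e : - ax j k = av j - if k = bar j then 0 else av k := by
    unfold ax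
    split_ifs <;> ring
  rw [e]

theorem ax_ne_zero {j k : Fin (2*n)} (hjk : j ≠ k) : ax j k ≠ 0 := by
  unfold ax
  split_ifs with h
  · simpa using av_ne_zero j
  · intro h0
    exact hjk (av_injective (by linear_combination - h0))

theorem prime_ax {j k : Fin (2*n)} (hjk : j ≠ k) : Prime (ax j k) := by
  obtain ⟨φ, -, -, h⟩ := exists_ax_dvd_iff hjk
  refine ⟨ax_ne_zero hjk, ?_, fun a b => ?_⟩
  · rw [isUnit_iff_dvd_one, h]
    simp
  · simp [h]

theorem not_ax_dvd_ax {j k l : Fin (2*n)} (hjk : j ≠ k) (hjl : j ≠ l) (hkl : k ≠ l) :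
    ¬ ax j k ∣ ax j l := by
  obtain ⟨φ, h1, h2, h⟩ := exists_ax_dvd_iff hjk
  rw [h]
  by_cases hl : l = bar j
  · have hk : k ≠ bar j := fun e => hkl (e.trans hl.symm)
    simpa [ax, hl, h1, hk] using av_ne_zero k
  · rw [ax, if_neg hl, map_add, map_neg, h1, h2 l hjl.symm hl]
    split_ifs with hk
    · simpa using av_ne_zero l
    · intro h0
      exact hkl (av_injective (by linear_combination - h0))

theorem prod_ax_dvd {j : Fin (2*n)} {S : Finset (Fin (2*n))} (hj : j ∉ S) {f : Rr n}
    (hf : ∀ k ∈ S, ax j k ∣ f) : ∏ k ∈ S, ax j k ∣ f := by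
  have hne : ∀ k ∈ S, j ≠ k := fun k hk e => hj (e ▸ hk)
  refine Finset.prod_dvd_of_isRelPrime (fun k hk l hl hkl => ?_) hf
  exact (prime_ax (hne k hk)).irreducible.isRelPrime_iff_not_dvd.mpr
    (not_ax_dvd_ax (hne k hk) (hne l hl) hkl)

theorem not_ax_dvd_prod {j k : Fin (2*n)} {S : Finset (Fin (2*n))} (hjk : j ≠ k)
    (hj : j ∉ S) (hk : k ∉ S) : ¬ ax j k ∣ ∏ l ∈ S, ax j l := by
  rw [(prime_ax hjk).dvd_finsetProd_iff]
  rintro ⟨l, hl, h⟩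
  exact not_ax_dvd_ax hjk (fun e => hj (e ▸ hl)) (fun e => hk (e ▸ hl)) h

end Weights

section Independent

variable {n : ℕ} {K : Finset (Fin (2*n))}

theorem indep.bar_notMem (hK : indep K) {i : Fin (2*n)} (hi : i ∈ K) : bar i ∉ K := by
  intro h
  exact hK i (by simp [insert_subset_iff, hi, h])

theorem indep.compl_eq_image (hK : indep K) (hKc : K.card = n) : Kᶜ = K.image bar := by
  symm
  apply Finset.eq_of_subset_of_card_le
  · intro i hi
    obtain ⟨j, hj, rfl⟩ := mem_image.mp hi
    exact mem_compl.mpr (hK.bar_notMem hj)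
  · rw [card_image_of_injective _ bar_injective, card_compl, Fintype.card_fin]
    omega

theorem indep.ne_bar (hK : indep K) {i j : Fin (2*n)} (hi : i ∈ K) (hj : j ∈ K) :
    j ≠ bar i := by
  rintro rfl
  exact hK.bar_notMem hi hj

theorem indep.compl (hK : indep K) (hKc : K.card = n) : indep Kᶜ := by
  intro i hi
  rw [insert_subset_iff, singleton_subset_iff, hK.compl_eq_image hKc, mem_image, mem_image] at hi
  obtain ⟨⟨a, ha, rfl⟩, b, hb, h⟩ := hi
  exact hK.ne_bar ha hb (bar_injective h)

theorem two_mul_Del (hK : indep K) (hKc : K.card = n) (j : Fin (2*n)) :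
    2 * Del K j = ∏ l ∈ K, (- av j - av l) := by
  by_cases hj : j ∈ K
  · rw [Del, if_pos hj, hK.compl_eq_image hKc, prod_image bar_injective.injOn,
      ← mul_prod_erase K _ hj, ← mul_prod_erase K (fun l => - av j - av l) hj]
    have e : ∏ x ∈ K.erase j, ax j (bar x) = ∏ x ∈ K.erase j, (- av j - av x) := by
      refine prod_congr rfl fun x hx => ?_
      rw [ax, if_neg fun h => (mem_erase.mp hx).1 (bar_injective h), av_bar]
      ring
    rw [e, ax, if_pos rfl]
    ring
  · have hb : bar j ∈ K := by
      have : j ∈ K.image bar := hK.compl_eq_image hKc ▸ mem_compl.mpr hj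
      obtain ⟨i, hi, rfl⟩ := mem_image.mp this
      rwa [bar_bar]
    rw [Del, if_neg hj, mul_zero, eq_comm]
    exact prod_eq_zero hb (by rw [av_bar]; ring)

/-- On `K`, the class `Δ_K` is a polynomial in `Q` whose coefficients have no constant term. -/
theorem exists_poly_Del (hK : indep K) (hKc : K.card = n) : ∃ P : Polynomial (Rr n),
    P.map (constantCoeff (R := ℤ) (σ := Fin n)) = 0 ∧ ∀ j ∈ K, Del K j = P.eval (- av j) := by
  obtain ⟨P, hP, h0⟩ := exists_half_prod_sub_prod (constantCoeff (R := ℤ) (σ := Fin n))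
    av constantCoeff_av K
  refine ⟨P, h0, fun j hj => ?_⟩
  have h := congrArg (Polynomial.eval (- av j)) hP
  have hz : ∏ l ∈ K, (- av j + av l) = 0 := prod_eq_zero hj (by ring)
  simp only [Polynomial.eval_sub, Polynomial.eval_prod, Polynomial.eval_mul, Polynomial.eval_add,
    Polynomial.eval_X, Polynomial.eval_C, Polynomial.eval_ofNat, hz, sub_zero,
    ← two_mul_Del hK hKc] at h
  exact mul_left_cancel₀ two_ne_zero h

theorem ax_eq_of_ne {i j : Fin (2*n)} (h : j ≠ bar i) : ax i j = - av i - - av j := by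
  rw [ax, if_neg h]; ring

theorem Del_mem (hK : indep K) (hKc : K.card = n) : Del K ∈ HGQ n := by
  intro i j hij
  obtain ⟨P, -, hP⟩ := exists_poly_Del hK hKc
  by_cases hi : i ∈ K
  · by_cases hj : j ∈ K
    · rw [hP i hi, hP j hj, ax_eq_of_ne (hK.ne_bar hi hj)]
      exact Polynomial.sub_dvd_eval_sub _ _ _
    · rw [Del, Del, if_pos hi, if_neg hj, sub_zero]
      exact dvd_prod_of_mem _ (mem_compl.mpr hj)
  · by_cases hj : j ∈ K
    · rw [Del, Del, if_neg hi, if_pos hj, zero_sub, dvd_neg]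
      have h : ax j i ∣ ∏ k ∈ Kᶜ, ax j k := dvd_prod_of_mem _ (mem_compl.mpr hi)
      refine dvd_trans ?_ h
      by_cases hb : j = bar i
      · rw [ax, ax, if_pos hb, if_pos (by rw [hb, bar_bar]), hb, av_bar]
        simp
      · have hb' : i ≠ bar j := fun e => hb (by rw [e, bar_bar])
        rw [ax_eq_of_ne hb, ax_eq_of_ne hb', ← neg_dvd]
        exact dvd_of_eq (by ring)
    · simp [Del, hi, hj]

theorem Qf_mem : Qf ∈ HGQ n := by
  intro i j _
  by_cases h : j = bar i
  · rw [Qf, Qf, ax, if_pos h, h, av_bar]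
    exact ⟨2, by ring⟩
  · rw [ax_eq_of_ne h, Qf, Qf]

/-- The class `Q` as an element of the graph cohomology. -/
def Qh (n : ℕ) : HGQ n := ⟨Qf, Qf_mem⟩

/-- The constant functions. -/
def cst (n : ℕ) : Rr n →+* HGQ n where
  toFun r := ⟨fun _ => r, fun i j _ => by simp⟩
  map_one' := rfl
  map_mul' _ _ := rfl
  map_zero' := rfl
  map_add' _ _ := rfl

theorem eval₂_cst_apply (P : Polynomial (Rr n)) (j : Fin (2*n)) :
    (P.eval₂ (cst n) (Qh n) : HGQ n).1 j = P.eval (- av j) := by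
  have h := Polynomial.hom_eval₂ P (cst n)
    ((Pi.evalRingHom (fun _ : Fin (2*n) => Rr n) j).comp (HGQ n).subtype) (Qh n)
  exact h

theorem exists_poly_of_indep {S : Finset (Fin (2*n))} (hS : indep S) (f : Fin (2*n) → Rr n)
    (hf : ∀ i ∈ S, ∀ j ∈ S, i ≠ j → ax i j ∣ f i - f j) :
    ∃ P : Polynomial (Rr n), P.degree < S.card ∧ ∀ i ∈ S, P.eval (- av i) = f i := by
  refine exists_interpolating_poly (fun i => - av i) S f (fun i hi j hj hij => ?_)
    (fun i hi j hj k hk hij hik hjk c hc => ?_)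
  · rw [← ax_eq_of_ne (hS.ne_bar hi hj)]
    exact hf i hi j hj hij
  · rw [← ax_eq_of_ne (hS.ne_bar hi hj)] at hc ⊢
    rw [← ax_eq_of_ne (hS.ne_bar hi hk)] at hc
    exact ((prime_ax hij).dvd_or_dvd hc).resolve_right (not_ax_dvd_ax hij hik hjk)

/-- The powers `Q ^ i` and `Δ_K * Q ^ i` with `i < n` span the graph cohomology over the
constants. -/
theorem exists_repr (hK : indep K) (hKc : K.card = n) (f : HGQ n) :
    ∃ P q : Polynomial (Rr n), P.degree < n ∧ q.degree < n ∧
      f = P.eval₂ (cst n) (Qh n) + ⟨Del K, Del_mem hK hKc⟩ * q.eval₂ (cst n) (Qh n) := by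
  have hcc : (Kᶜ).card = n := by
    rw [card_compl, Fintype.card_fin]; omega
  obtain ⟨P, hPd, hP⟩ := exists_poly_of_indep (hK.compl hKc) f.1 (fun i _ j _ => f.2 i j)
  set g : HGQ n := f - P.eval₂ (cst n) (Qh n) with hg
  have hg0 : ∀ k ∉ K, g.1 k = 0 := by
    intro k hk
    have : g.1 k = f.1 k - (P.eval₂ (cst n) (Qh n) : HGQ n).1 k := rfl
    rw [this, eval₂_cst_apply, hP k (mem_compl.mpr hk), sub_self]
  have hdvd : ∀ j, ∃ h, g.1 j = Del K j * h := by
    intro j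
    by_cases hj : j ∈ K
    · rw [Del, if_pos hj]
      refine prod_ax_dvd (by simpa using hj) fun k hk => ?_
      have hk' := mem_compl.mp hk
      have := g.2 j k (fun e => hk' (e ▸ hj))
      rwa [hg0 k hk', sub_zero] at this
    · exact ⟨0, by rw [hg0 j hj, mul_zero]⟩
  choose h hh using hdvd
  obtain ⟨q, hqd, hq⟩ := exists_poly_of_indep hK h (by
    intro i hi j hj hij
    have h1 : ax i j ∣ Del K i * (h i - h j) := by
      have e : Del K i * (h i - h j) = (g.1 i - g.1 j) - (Del K i - Del K j) * h j := by
        rw [hh i, hh j]; ring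
      rw [e]
      exact dvd_sub (g.2 i j hij) ((Del_mem hK hKc i j hij).mul_right _)
    refine ((prime_ax hij).dvd_or_dvd h1).resolve_left ?_
    rw [Del, if_pos hi]
    exact not_ax_dvd_prod hij (by simpa using hi) (by simpa using hj))
  rw [hcc] at hPd
  rw [hKc] at hqd
  refine ⟨P, q, hPd, hqd, ?_⟩
  rw [← sub_eq_iff_eq_add', ← hg]
  ext1
  funext j
  change g.1 j = Del K j * (q.eval₂ (cst n) (Qh n) : HGQ n).1 j
  rw [eval₂_cst_apply, hh]
  by_cases hj : j ∈ K
  · rw [hq j hj]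
  · simp [Del, hj]

theorem eq_zero_of_repr_eq_zero (hK : indep K) (hKc : K.card = n) {P q : Polynomial (Rr n)}
    (hP : P.degree < n) (hq : q.degree < n)
    (h : P.eval₂ (cst n) (Qh n) + ⟨Del K, Del_mem hK hKc⟩ * q.eval₂ (cst n) (Qh n) = 0) :
    P = 0 ∧ q = 0 := by
  have hcc : (Kᶜ).card = n := by
    rw [card_compl, Fintype.card_fin]; omega
  have hj (j : Fin (2*n)) : P.eval (- av j) + Del K j * q.eval (- av j) = 0 := by
    rw [← eval₂_cst_apply, ← eval₂_cst_apply]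
    exact congrFun (congrArg Subtype.val h) j
  have hinj : Function.Injective fun j : Fin (2*n) => - av j :=
    neg_injective.comp av_injective
  have hP0 : P = 0 := by
    refine Polynomial.eq_zero_of_degree_lt_of_eval_index_eq_zero (s := Kᶜ)
      (v := fun j => - av j) hinj.injOn (by rwa [hcc]) fun j hjK => ?_
    simpa [Del, mem_compl.mp hjK] using hj j
  refine ⟨hP0, ?_⟩
  refine Polynomial.eq_zero_of_degree_lt_of_eval_index_eq_zero (s := K)
    (v := fun j => - av j) hinj.injOn (by rwa [hKc]) fun j hjK => ?_
  have := hj j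
  rw [hP0, Polynomial.eval_zero, zero_add] at this
  refine (mul_eq_zero.mp this).resolve_left ?_
  rw [Del, if_pos hjK]
  exact prod_ne_zero_iff.mpr fun k hk => ax_ne_zero fun e => mem_compl.mp hk (e ▸ hjK)

end Independent

section Quotient

variable {n : ℕ} {K : Finset (Fin (2*n))}

theorem Mv_sub_Qf (i : Fin (2*n)) : Mv i - Qf = fun _ => av i := by
  funext j
  simp only [Pi.sub_apply, Mv, Qf]
  split_ifs with h1 h2
  · rw [h1]; ring
  · rw [h2, av_bar]; ring
  · ring

theorem Jideal_eq_span (n : ℕ) :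
    Jideal n = Ideal.span (Set.range fun m : Fin n => cst n (X m)) := by
  rw [Jideal]
  congr 1
  ext g
  constructor
  · rintro ⟨i, hi, h⟩
    refine ⟨⟨i, hi⟩, Subtype.ext ?_⟩
    rw [h, Mv_sub_Qf]
    exact funext fun _ => (av_vtx ⟨i, hi⟩).symm
  · rintro ⟨m, rfl⟩
    refine ⟨vtx m, m.isLt, ?_⟩
    rw [Mv_sub_Qf, av_vtx]
    rfl

theorem mk_eval₂ (P : Polynomial (Rr n)) :
    Ideal.Quotient.mk (Jideal n) (P.eval₂ (cst n) (Qh n)) =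
      Polynomial.aeval (Ideal.Quotient.mk (Jideal n) (Qh n))
        (P.map (constantCoeff (R := ℤ) (σ := Fin n))) := by
  have h : (Ideal.Quotient.mk (Jideal n)).comp (cst n) =
      (algebraMap ℤ (HGQ n ⧸ Jideal n)).comp (constantCoeff (R := ℤ) (σ := Fin n)) := by
    apply MvPolynomial.ringHom_ext
    · intro a
      simp
    · intro m
      simp only [RingHom.comp_apply, constantCoeff_X, map_zero]
      rw [Ideal.Quotient.eq_zero_iff_mem, Jideal_eq_span]
      exact Ideal.subset_span ⟨m, rfl⟩
  rw [Polynomial.hom_eval₂, h, Polynomial.aeval_def, Polynomial.eval₂_map]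

theorem mk_Q_pow (hK : indep K) (hKc : K.card = n) :
    Ideal.Quotient.mk (Jideal n) (Qh n) ^ n =
      2 * Ideal.Quotient.mk (Jideal n) ⟨Del K, Del_mem hK hKc⟩ := by
  have e : 2 * ⟨Del K, Del_mem hK hKc⟩ = (∏ l ∈ K, (Polynomial.X - Polynomial.C (av l))).eval₂
      (cst n) (Qh n) := by
    ext1
    funext j
    rw [eval₂_cst_apply]
    change 2 * Del K j = _
    simp [two_mul_Del hK hKc, Polynomial.eval_prod]
  have h := mk_eval₂ (∏ l ∈ K, (Polynomial.X - Polynomial.C (av l)))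
  rw [← e] at h
  rw [map_mul, map_ofNat] at h
  simpa [Polynomial.map_prod, Polynomial.map_sub, constantCoeff_av, hKc] using h.symm

theorem mk_Del_sq (hK : indep K) (hKc : K.card = n) :
    Ideal.Quotient.mk (Jideal n) ⟨Del K, Del_mem hK hKc⟩ ^ 2 = 0 := by
  obtain ⟨P, h0, hP⟩ := exists_poly_Del hK hKc
  have e : (⟨Del K, Del_mem hK hKc⟩ : HGQ n) ^ 2 =
      ⟨Del K, Del_mem hK hKc⟩ * P.eval₂ (cst n) (Qh n) := by
    ext1
    funext j
    change Del K j ^ 2 = Del K j * (P.eval₂ (cst n) (Qh n) : HGQ n).1 j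
    rw [eval₂_cst_apply]
    by_cases hj : j ∈ K
    · rw [← hP j hj, sq]
    · simp [Del, hj]
  rw [← map_pow, e, map_mul, mk_eval₂, h0, map_zero, mul_zero]

theorem exists_repr_of_mem_Jideal (hK : indep K) (hKc : K.card = n) {f : HGQ n}
    (hf : f ∈ Jideal n) :
    ∃ P q : Polynomial (Rr n), P.degree < n ∧ q.degree < n ∧
      P.map (constantCoeff (R := ℤ) (σ := Fin n)) = 0 ∧
      q.map (constantCoeff (R := ℤ) (σ := Fin n)) = 0 ∧
      f = P.eval₂ (cst n) (Qh n) + ⟨Del K, Del_mem hK hKc⟩ * q.eval₂ (cst n) (Qh n) := by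
  rw [Jideal_eq_span, Ideal.mem_span_range_iff_exists_fun] at hf
  obtain ⟨c, rfl⟩ := hf
  choose P q hP hq h using fun m => exists_repr hK hKc (c m)
  have hdeg (p : Fin n → Polynomial (Rr n)) (hp : ∀ m, (p m).degree < n) :
      (∑ m, Polynomial.C (X m : Rr n) * p m).degree < (n : WithBot ℕ) := by
    rw [← Polynomial.mem_degreeLT]
    refine sum_mem fun m _ => ?_
    rw [← Polynomial.smul_eq_C_mul]
    exact Submodule.smul_mem _ _ (Polynomial.mem_degreeLT.mpr (hp m))
  refine ⟨∑ m, Polynomial.C (X m) * P m, ∑ m, Polynomial.C (X m) * q m, hdeg P hP, hdeg q hq,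
    by simp [Polynomial.map_sum], by simp [Polynomial.map_sum], ?_⟩
  simp only [Polynomial.eval₂_finsetSum, Polynomial.eval₂_mul, Polynomial.eval₂_C, mul_sum,
    ← sum_add_distrib]
  refine sum_congr rfl fun m _ => ?_
  conv_lhs => rw [h m]
  ring

theorem eq_zero_of_aeval_eq_zero (hK : indep K) (hKc : K.card = n) {P q : Polynomial ℤ}
    (hP : P.degree < n) (hq : q.degree < n)
    (h : Polynomial.aeval (Ideal.Quotient.mk (Jideal n) (Qh n)) P +
      Ideal.Quotient.mk (Jideal n) ⟨Del K, Del_mem hK hKc⟩ *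
        Polynomial.aeval (Ideal.Quotient.mk (Jideal n) (Qh n)) q = 0) :
    P = 0 ∧ q = 0 := by
  have hε : (constantCoeff (R := ℤ) (σ := Fin n)).comp C = RingHom.id ℤ := RingHom.ext_int _ _
  have hmap (p : Polynomial ℤ) :
      (p.map (C : ℤ →+* Rr n)).map (constantCoeff (R := ℤ) (σ := Fin n)) = p := by
    rw [Polynomial.map_map, hε, Polynomial.map_id]
  have hmk (p : Polynomial ℤ) : Polynomial.aeval (Ideal.Quotient.mk (Jideal n) (Qh n)) p =
      Ideal.Quotient.mk (Jideal n) ((p.map (C : ℤ →+* Rr n)).eval₂ (cst n) (Qh n)) := by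
    rw [mk_eval₂, hmap]
  rw [hmk, hmk, ← map_mul, ← map_add, Ideal.Quotient.eq_zero_iff_mem] at h
  obtain ⟨P', q', hP', hq', hP0, hq0, e⟩ := exists_repr_of_mem_Jideal hK hKc h
  have hlt {p p' : Polynomial (Rr n)} (h1 : p.degree < n) (h2 : p'.degree < n) :
      (p - p').degree < n :=
    (Polynomial.degree_sub_le p p').trans_lt (max_lt h1 h2)
  obtain ⟨h1, h2⟩ := eq_zero_of_repr_eq_zero hK hKc
    (hlt (Polynomial.degree_map_le.trans_lt hP) hP')
    (hlt (Polynomial.degree_map_le.trans_lt hq) hq') (by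
      rw [Polynomial.eval₂_sub, Polynomial.eval₂_sub]
      linear_combination e)
  constructor
  · rw [← hmap P, sub_eq_zero.mp h1, hP0]
  · rw [← hmap q, sub_eq_zero.mp h2, hq0]

end Quotient

/-- H*(GQ_{2n−1})/𝒥 ≅ ℤ[c,x]/⟨c^n − 2x, x²⟩, with the images of Q and Δ_K
corresponding to c and x respectively; in particular Q^n − 2Δ_K ∈ 𝒥 and Δ_K² ∈ 𝒥. -/
theorem stmt15 (n : ℕ) (hn : 1 ≤ n) (K : Finset (Fin (2*n)))
    (hK : indep K) (hKc : K.card = n) :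
    (∃ e : (HGQ n ⧸ Jideal n) ≃+* (MvPolynomial (Fin 2) ℤ ⧸
        Ideal.span {(X 0 : MvPolynomial (Fin 2) ℤ) ^ n - 2 * X 1,
          (X 1 : MvPolynomial (Fin 2) ℤ) ^ 2}),
      (∀ g : HGQ n, (g : Fin (2*n) → Rr n) = Qf →
        e (Ideal.Quotient.mk (Jideal n) g) =
          Ideal.Quotient.mk _ (X 0 : MvPolynomial (Fin 2) ℤ)) ∧
      (∀ g : HGQ n, (g : Fin (2*n) → Rr n) = Del K →
        e (Ideal.Quotient.mk (Jideal n) g) =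
          Ideal.Quotient.mk _ (X 1 : MvPolynomial (Fin 2) ℤ))) ∧
    (∀ g : HGQ n, (g : Fin (2*n) → Rr n) = Qf ^ n - 2 * Del K → g ∈ Jideal n) ∧
    (∀ g : HGQ n, (g : Fin (2*n) → Rr n) = Del K * Del K → g ∈ Jideal n) := by
  set Δ : HGQ n := ⟨Del K, Del_mem hK hKc⟩ with hΔ
  set c := Ideal.Quotient.mk (Jideal n) (Qh n) with hc
  set x := Ideal.Quotient.mk (Jideal n) Δ with hx
  have h1 : c ^ n = 2 * x := mk_Q_pow hK hKc
  have h2 : x ^ 2 = 0 := mk_Del_sq hK hKc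
  set I : Ideal (MvPolynomial (Fin 2) ℤ) :=
    Ideal.span {(X 0 : MvPolynomial (Fin 2) ℤ) ^ n - 2 * X 1, (X 1) ^ 2} with hI
  have hIker : ∀ F ∈ I, (aeval ![c, x] : MvPolynomial (Fin 2) ℤ →ₐ[ℤ] _).toRingHom F = 0 := by
    intro F hF
    have hle : I ≤ RingHom.ker (aeval ![c, x] : MvPolynomial (Fin 2) ℤ →ₐ[ℤ] _).toRingHom := by
      rw [hI, Ideal.span_le]
      rintro _ (rfl | rfl)
      · simp [RingHom.mem_ker, h1]
      · simp [RingHom.mem_ker, h2]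
    exact hle hF
  set ψ := Ideal.Quotient.lift I _ hIker with hψ
  have hψ0 : ψ (Ideal.Quotient.mk I (X 0)) = c := by simp [hψ]
  have hψ1 : ψ (Ideal.Quotient.mk I (X 1)) = x := by simp [hψ]
  have hψp (p : Polynomial ℤ) :
      ψ (Polynomial.aeval (Ideal.Quotient.mk I (X 0)) p) = Polynomial.aeval c p := by
    rw [← hψ0]
    exact (Polynomial.aeval_algHom_apply ψ.toIntAlgHom _ p).symm
  have hinj : Function.Injective ψ := by
    rw [injective_iff_map_eq_zero]
    intro a ha
    obtain ⟨F, rfl⟩ := Ideal.Quotient.mk_surjective a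
    have r1 : Ideal.Quotient.mk I (X 0) ^ n = 2 * Ideal.Quotient.mk I (X 1) := by
      rw [← sub_eq_zero, ← map_pow, ← map_ofNat (Ideal.Quotient.mk I) 2, ← map_mul, ← map_sub,
        Ideal.Quotient.eq_zero_iff_mem]
      exact Ideal.subset_span (by simp)
    have r2 : Ideal.Quotient.mk I (X 1) ^ 2 = 0 := by
      rw [← map_pow, Ideal.Quotient.eq_zero_iff_mem]
      exact Ideal.subset_span (by simp)
    obtain ⟨P, q, hP, hq, e⟩ := aeval_eq_normal_form r1 r2 F
    have hF : aeval ![Ideal.Quotient.mk I (X 0), Ideal.Quotient.mk I (X 1)] F =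
        Ideal.Quotient.mk I F := by
      have : (aeval ![Ideal.Quotient.mk I (X 0), Ideal.Quotient.mk I (X 1)] :
          MvPolynomial (Fin 2) ℤ →ₐ[ℤ] _) = Ideal.Quotient.mkₐ ℤ I := by
        apply MvPolynomial.algHom_ext
        intro i
        fin_cases i <;> simp
      rw [this]
      rfl
    rw [hF] at e
    rw [e, map_add, map_mul, hψp, hψp, hψ1] at ha
    obtain ⟨rfl, rfl⟩ := eq_zero_of_aeval_eq_zero hK hKc hP hq ha
    simp [e]
  have hsurj : Function.Surjective ψ := by
    intro b
    obtain ⟨f, rfl⟩ := Ideal.Quotient.mk_surjective b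
    obtain ⟨P, q, -, -, e⟩ := exists_repr hK hKc f
    refine ⟨Polynomial.aeval (Ideal.Quotient.mk I (X 0)) (P.map constantCoeff) +
      Ideal.Quotient.mk I (X 1) *
        Polynomial.aeval (Ideal.Quotient.mk I (X 0)) (q.map constantCoeff), ?_⟩
    rw [map_add, map_mul, hψp, hψp, hψ1, e, map_add, map_mul, mk_eval₂, mk_eval₂]
  refine ⟨⟨(RingEquiv.ofBijective ψ ⟨hinj, hsurj⟩).symm, ?_, ?_⟩, ?_, ?_⟩
  · intro g hg
    obtain rfl : g = Qh n := Subtype.ext hg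
    rw [RingEquiv.symm_apply_eq]
    exact hψ0.symm
  · intro g hg
    obtain rfl : g = Δ := Subtype.ext hg
    rw [RingEquiv.symm_apply_eq]
    exact hψ1.symm
  · intro g hg
    obtain rfl : g = Qh n ^ n - 2 * Δ := Subtype.ext hg
    rw [← Ideal.Quotient.eq_zero_iff_mem, map_sub, map_mul, map_pow, map_ofNat, sub_eq_zero]
    exact h1
  · intro g hg
    obtain rfl : g = Δ * Δ := Subtype.ext hg
    rw [← Ideal.Quotient.eq_zero_iff_mem, map_mul, ← sq]
    exact h2

end
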